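/- arXiv:1612.08819 — 2 statements merged into one kernel-verified Lean document; each statement's English description precedes it below -/
import Mathlib

section
/- (Peetre) Let 0 < α < n, 1 < q ≤ p < ∞ and 1 < t ≤ s < ∞ with 1/s = 1/p − α/n and 1/t = 1/q − α/n. Then there is a constant C, depending only on n, α, p, q, such that for every nonnegative measurable function f on ℝⁿ, ‖I_α f‖_{M^s_t} ≤ C ‖f‖_{M^p_q}. -/
open MeasureTheory ENNReal

noncomputable section

/-- `ℝⁿ` with the Euclidean norm. -/
abbrev En (n : ℕ) := EuclideanSpace ℝ (Fin n)

/-- The open cube in `ℝⁿ` centered at `c` with half side length `r`. -/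
def cube {n : ℕ} (c : En n) (r : ℝ) : Set (En n) := {y | ∀ i, |y i - c i| < r}

/-- Morrey norm `‖f‖_{M^p_q}`. -/
def morreyNorm {n : ℕ} (p q : ℝ) (f : En n → ℂ) : ℝ≥0∞ :=
  ⨆ (c : En n) (r : ℝ) (_ : 0 < r),
    volume (cube c r) ^ (1 / p - 1 / q) *
      (∫⁻ y in cube c r, (‖f y‖₊ : ℝ≥0∞) ^ q) ^ (1 / q)

/-- Weak Morrey norm `‖f‖_{WM^p_q}`. -/
def weakMorreyNorm {n : ℕ} (p q : ℝ) (f : En n → ℂ) : ℝ≥0∞ :=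
  ⨆ (c : En n) (r : ℝ) (_ : 0 < r),
    volume (cube c r) ^ (1 / p - 1 / q) *
      ⨆ (t : ℝ) (_ : 0 < t),
        (ENNReal.ofReal t ^ q * volume {y ∈ cube c r | t < ‖f y‖}) ^ (1 / q)

/-- Weak Lebesgue quasinorm `‖f‖_{L^{p,∞}}`. -/
def weakLpNorm {n : ℕ} (p : ℝ) (f : En n → ℂ) : ℝ≥0∞ :=
  ⨆ (t : ℝ) (_ : 0 < t),
    ENNReal.ofReal t * volume {x : En n | t < ‖f x‖} ^ (1 / p)

/-- The average `b_Q` of `b` over the cube `Q = cube c r`. -/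
def cubeAvg {n : ℕ} (b : En n → ℝ) (c : En n) (r : ℝ) : ℝ :=
  (∫ x in cube c r, b x) / (volume (cube c r)).toReal

/-- The BMO seminorm `‖b‖_*`. -/
def bmoSeminorm {n : ℕ} (b : En n → ℝ) : ℝ≥0∞ :=
  ⨆ (c : En n) (r : ℝ) (_ : 0 < r),
    (volume (cube c r))⁻¹ *
      ∫⁻ x in cube c r, (‖b x - cubeAvg b c r‖₊ : ℝ≥0∞)

/-- The Lipschitz (Hölder) seminorm `‖b‖_{Lip_α}`. -/
def lipSeminorm {n : ℕ} (α : ℝ) (b : En n → ℝ) : ℝ≥0∞ :=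
  ⨆ (x : En n) (y : En n) (_ : x ≠ y),
    (‖b x - b y‖₊ : ℝ≥0∞) / edist x y ^ α

/-- `sup_Q |Q|^{-(1+α/n)} ∫_Q |b - b_Q|`. -/
def lipAvgNorm {n : ℕ} (α : ℝ) (b : En n → ℝ) : ℝ≥0∞ :=
  ⨆ (c : En n) (r : ℝ) (_ : 0 < r),
    volume (cube c r) ^ (-(1 + α / (n : ℝ))) *
      ∫⁻ x in cube c r, (‖b x - cubeAvg b c r‖₊ : ℝ≥0∞)

/-- The fractional integral `I_α g (x) = ∫ g(y) / |x-y|^{n-α} dy` of a nonnegative function. -/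
def fracIntegral {n : ℕ} (α : ℝ) (g : En n → ℝ≥0∞) (x : En n) : ℝ≥0∞ :=
  ∫⁻ y, g y / edist x y ^ ((n : ℝ) - α)

/-- Morrey norm `‖g‖_{M^p_q}` of a nonnegative (extended-real-valued) function. -/
def morreyNormE {n : ℕ} (p q : ℝ) (g : En n → ℝ≥0∞) : ℝ≥0∞ :=
  ⨆ (c : En n) (r : ℝ) (_ : 0 < r),
    volume (cube c r) ^ (1 / p - 1 / q) * (∫⁻ y in cube c r, g y ^ q) ^ (1 / q)

/-- `E x = 2 ^ x` as an extended nonnegative real. -/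
def E (x : ℝ) : ℝ≥0∞ := (2 : ℝ≥0∞) ^ x

lemma E_ne_zero (x : ℝ) : E x ≠ 0 := by
  unfold E; exact (ENNReal.rpow_pos (by norm_num) (by norm_num)).ne'

lemma E_ne_top (x : ℝ) : E x ≠ ∞ := by
  unfold E; exact ENNReal.rpow_ne_top_of_ne_zero (by norm_num) (by norm_num)

lemma E_add (x y : ℝ) : E (x + y) = E x * E y := by
  unfold E; exact ENNReal.rpow_add _ _ (by norm_num) (by norm_num)

lemma E_rpow (x y : ℝ) : E x ^ y = E (x * y) := by
  unfold E; rw [ENNReal.rpow_mul]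

lemma E_zero : E 0 = 1 := by simp [E]

lemma E_mono {x y : ℝ} (h : x ≤ y) : E x ≤ E y := by
  unfold E; exact ENNReal.rpow_le_rpow_of_exponent_le (by norm_num) h

lemma E_strict {x y : ℝ} (h : x < y) : E x < E y := by
  unfold E; exact ENNReal.rpow_lt_rpow_of_exponent_lt (by norm_num) (by norm_num) h

lemma E_le_iff {x y : ℝ} : E x ≤ E y ↔ x ≤ y :=
  ⟨fun h => by by_contra hc; exact absurd (E_strict (not_le.1 hc)) (not_lt.2 h), E_mono⟩

lemma E_lt_iff {x y : ℝ} : E x < E y ↔ x < y := by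
  rw [← not_le, E_le_iff, not_le]

lemma E_ofReal (x : ℝ) : E x = ENNReal.ofReal ((2 : ℝ) ^ x) := by
  unfold E
  rw [← ENNReal.ofReal_rpow_of_pos (by norm_num)]
  norm_num

lemma exists_E {x : ℝ≥0∞} (h0 : x ≠ 0) (h1 : x ≠ ∞) : ∃ a : ℝ, x = E a := by
  refine ⟨Real.logb 2 x.toReal, ?_⟩
  have : 0 < x.toReal := ENNReal.toReal_pos h0 h1
  rw [E_ofReal, Real.rpow_logb (by norm_num) (by norm_num) this, ENNReal.ofReal_toReal h1]

lemma min_sum_finite {a b : ℝ} (ha : 0 < a) (hb : 0 < b) :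
    ∑' j : ℤ, min (E (j * a)) (E ((1 - j) * b)) ≠ ∞ := by
  have geo : ∀ c : ℝ, 0 < c → ∑' j : ℕ, E (-(j * c)) ≠ ∞ := by
    intro c hc
    have : ∀ j : ℕ, E (-(j * c)) = (E (-c)) ^ j := by
      intro j
      rw [← ENNReal.rpow_natCast, E_rpow]; congr 1; ring
    simp_rw [this]
    rw [ENNReal.tsum_geometric]
    apply ENNReal.inv_ne_top.2
    have : E (-c) < 1 := by rw [← E_zero]; exact E_strict (by linarith)
    exact (tsub_pos_of_lt this).ne'
  rw [tsum_of_nat_of_neg_add_one ENNReal.summable ENNReal.summable]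
  apply ENNReal.add_ne_top.2
  constructor
  · refine ne_top_of_le_ne_top (ENNReal.mul_ne_top (E_ne_top b) (geo b hb)) ?_
    rw [← ENNReal.tsum_mul_left]
    refine ENNReal.tsum_le_tsum fun j => (min_le_right _ _).trans ?_
    rw [← E_add]; apply E_mono; push_cast; linarith
  · refine ne_top_of_le_ne_top (geo a ha) ?_
    refine ENNReal.tsum_le_tsum fun j => (min_le_left _ _).trans ?_
    apply E_mono; push_cast; nlinarith

lemma min_sum {a b : ℝ} (ha : 0 < a) (hb : 0 < b) :
    ∃ C : ℝ≥0∞, C ≠ ∞ ∧ ∀ M F : ℝ≥0∞,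
      ∑' k : ℤ, min (E (k * a) * M) (E (-(k * b)) * F) ≤
        C * (M ^ (b / (a + b)) * F ^ (a / (a + b))) := by
  have hab : 0 < a + b := by linarith
  have h1 : 0 < b / (a + b) := by positivity
  have h2 : 0 < a / (a + b) := by positivity
  set C := ∑' j : ℤ, min (E (j * a)) (E ((1 - j) * b)) with hC
  refine ⟨C, min_sum_finite ha hb, fun M F => ?_⟩
  have hC0 : C ≠ 0 := by
    rw [hC]
    intro h
    rw [ENNReal.tsum_eq_zero] at h
    have := h 0
    rcases min_choice (E (((0 : ℤ) : ℝ) * a)) (E ((1 - ((0 : ℤ) : ℝ)) * b)) with h' | h' <;>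
      rw [h'] at this <;> exact E_ne_zero _ this
  rcases eq_or_ne M 0 with rfl | hM0
  · simp
  rcases eq_or_ne F 0 with rfl | hF0
  · simp
  have hM0' : M ^ (b / (a + b)) ≠ 0 := by simp [hM0, not_lt.2 h1.le]
  have hF0' : F ^ (a / (a + b)) ≠ 0 := by simp [hF0, not_lt.2 h2.le]
  rcases eq_or_ne M ∞ with rfl | hM1
  · rw [ENNReal.top_rpow_of_pos h1, ENNReal.top_mul hF0', ENNReal.mul_top hC0]; exact le_top
  rcases eq_or_ne F ∞ with rfl | hF1
  · rw [ENNReal.top_rpow_of_pos h2, ENNReal.mul_top hM0', ENNReal.mul_top hC0]; exact le_top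
  obtain ⟨m, rfl⟩ := exists_E hM0 hM1
  obtain ⟨f, rfl⟩ := exists_E hF0 hF1
  rw [E_rpow, E_rpow, ← E_add]
  set D := m * (b / (a + b)) + f * (a / (a + b)) with hD
  set d := (f - m) / (a + b) with hd
  have e1 : d * a + m = D := by rw [hD, hd]; field_simp; ring
  have e2 : - (d * b) + f = D := by rw [hD, hd]; field_simp; ring
  have hl := Int.floor_le d
  have hu := Int.lt_floor_add_one d
  conv_rhs => rw [hC, ← (Equiv.subRight (⌊d⌋ : ℤ)).tsum_eq, ← ENNReal.tsum_mul_right]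
  refine ENNReal.tsum_le_tsum fun k => ?_
  rw [← E_add, ← E_add, min_mul, ← E_add, ← E_add]
  apply min_le_min
  · apply E_mono
    simp only [Equiv.subRight_apply]; push_cast; nlinarith
  · apply E_mono
    simp only [Equiv.subRight_apply]; push_cast; nlinarith

/-- one-sided geometric sum up to a threshold -/
lemma sum_lt {a : ℝ} (ha : 0 < a) :
    ∃ C : ℝ≥0∞, C ≠ ∞ ∧ ∀ u : ℝ≥0∞,
      ∑' k : ℤ, (if E k < u then E (k * a) else 0) ≤ C * u ^ a := by
  obtain ⟨C, hC, h⟩ := min_sum ha ha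
  refine ⟨C, hC, fun u => ?_⟩
  have h' := h 1 (u ^ (2 * a))
  rw [ENNReal.one_rpow, one_mul, ← ENNReal.rpow_mul] at h'
  have : 2 * a * (a / (a + a)) = a := by field_simp; ring
  rw [this] at h'
  refine le_trans (ENNReal.tsum_le_tsum fun k => ?_) h'
  split_ifs with hk
  · refine le_min (by simp) ?_
    calc E (k * a) = E (-(k * a)) * E k ^ (2 * a) := by
          rw [E_rpow, ← E_add]; congr 1; ring
      _ ≤ _ := by gcongr
  · exact zero_le

/-- one-sided geometric sum above a threshold -/
lemma sum_gt {b : ℝ} (hb : 0 < b) :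
    ∃ C : ℝ≥0∞, C ≠ ∞ ∧ ∀ ρ : ℝ,
      ∑' k : ℤ, (if ρ < (k : ℝ) then E (-(k * b)) else 0) ≤ C * E (-(ρ * b)) := by
  obtain ⟨C, hC, h⟩ := min_sum hb hb
  refine ⟨C, hC, fun ρ => ?_⟩
  have h' := h (E (-(ρ * (2 * b)))) 1
  rw [ENNReal.one_rpow, mul_one, E_rpow] at h'
  have : -(ρ * (2 * b)) * (b / (b + b)) = -(ρ * b) := by field_simp; ring
  rw [this] at h'
  refine le_trans (ENNReal.tsum_le_tsum fun k => ?_) h'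
  split_ifs with hk
  · refine le_min ?_ (by simp)
    rw [← E_add]; apply E_mono; nlinarith
  · exact zero_le

lemma exists_dyadic_Ico {u : ℝ≥0∞} (h0 : u ≠ 0) (h1 : u ≠ ∞) :
    ∃ k : ℤ, E k ≤ u ∧ u < E (k + 1) := by
  obtain ⟨a, rfl⟩ := exists_E h0 h1
  exact ⟨⌊a⌋, E_mono (Int.floor_le a), E_strict (Int.lt_floor_add_one a)⟩

lemma exists_dyadic_Ioc {u : ℝ≥0∞} (h0 : u ≠ 0) (h1 : u ≠ ∞) :
    ∃ k : ℤ, E k < u ∧ u ≤ E (k + 1) := by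
  obtain ⟨a, rfl⟩ := exists_E h0 h1
  refine ⟨⌈a⌉ - 1, E_strict ?_, E_mono ?_⟩
  · push_cast; linarith [Int.ceil_lt_add_one a]
  · push_cast; linarith [Int.le_ceil a]

lemma rpow_le_dyadic {q : ℝ} (hq : 0 < q) (u : ℝ≥0∞) :
    u ^ q ≤ ∑' k : ℤ, (if E k < u then E ((k + 1) * q) else 0) := by
  rcases eq_or_ne u 0 with rfl | h0
  · simp [hq]
  rcases eq_or_ne u ∞ with rfl | h1
  · have : ∀ N : ℕ, (N : ℝ≥0∞) ≤ ∑' k : ℤ, (if E k < ∞ then E ((k + 1) * q) else 0) := by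
      intro N
      calc (N : ℝ≥0∞) = ∑ k ∈ (Finset.range N).map ⟨fun i : ℕ => (i : ℤ), Nat.cast_injective⟩, 1 := by
            simp
        _ ≤ ∑ k ∈ (Finset.range N).map ⟨fun i : ℕ => (i : ℤ), Nat.cast_injective⟩,
              (if E k < ∞ then E ((k + 1) * q) else 0) := by
            apply Finset.sum_le_sum
            intro i hi
            simp only [Finset.mem_map, Finset.mem_range, Function.Embedding.coeFn_mk] at hi
            obtain ⟨j, _, rfl⟩ := hi
            rw [if_pos (E_ne_top _).lt_top, ← E_zero]
            apply E_mono; push_cast; positivity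
        _ ≤ _ := ENNReal.sum_le_tsum _
    have h2 : (∑' k : ℤ, (if E k < ∞ then E ((k + 1) * q) else 0)) = ∞ := by
      by_contra hne
      obtain ⟨N, hN⟩ := ENNReal.exists_nat_gt hne
      exact absurd (this N) (not_le.2 hN)
    rw [h2]; exact le_top
  obtain ⟨k, hk1, hk2⟩ := exists_dyadic_Ioc h0 h1
  refine le_trans ?_ (ENNReal.le_tsum k)
  rw [if_pos hk1, ← E_rpow]
  gcongr

/-- The open Euclidean ball of radius `2 ^ k`. -/
def dB {n : ℕ} (x : En n) (k : ℝ) : Set (En n) := {y | edist x y < E k}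

lemma dB_eq {n : ℕ} (x : En n) (k : ℝ) : dB x k = Metric.ball x ((2 : ℝ) ^ k) := by
  ext y
  simp only [dB, Set.mem_ofPred_eq, Metric.mem_ball, E_ofReal, edist_dist]
  rw [ENNReal.ofReal_lt_ofReal_iff (by positivity), dist_comm]

lemma measurableSet_dB {n : ℕ} (x : En n) (k : ℝ) : MeasurableSet (dB x k) := by
  rw [dB_eq]; exact measurableSet_ball

/-- Volume of the unit ball. -/
def vB (n : ℕ) : ℝ≥0∞ := volume (Metric.ball (0 : En n) 1)

lemma vB_ne_top (n : ℕ) : vB n ≠ ∞ := measure_ball_lt_top.ne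

lemma two_pow_E (k : ℝ) (n : ℕ) : ENNReal.ofReal (((2 : ℝ) ^ k) ^ n) = E (k * n) := by
  rw [E_ofReal, Real.rpow_mul (by norm_num), Real.rpow_natCast]

lemma volume_dB {n : ℕ} (x : En n) (k : ℝ) : volume (dB x k) = E (k * n) * vB n := by
  rw [dB_eq, Measure.addHaar_ball_of_pos _ _ (by positivity), vB, ← two_pow_E]
  simp

/-- Integral over the ball of radius `2 ^ k`. -/
def S {n : ℕ} (k : ℝ) (g : En n → ℝ≥0∞) (x : En n) : ℝ≥0∞ := ∫⁻ y in dB x k, g y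

lemma S_eq {n : ℕ} (k : ℝ) (g : En n → ℝ≥0∞) (x : En n) :
    S k g x = ∫⁻ y, (if edist x y < E k then g y else 0) := by
  unfold S
  rw [← lintegral_indicator (measurableSet_dB x k)]
  congr 1; ext y
  simp [Set.indicator_apply, dB]

lemma measurable_S {n : ℕ} (k : ℝ) {g : En n → ℝ≥0∞} (hg : Measurable g) :
    Measurable (S k g) := by
  have : S k g = fun x => ∫⁻ y, (if edist x y < E k then g y else 0) := by
    ext x; exact S_eq k g x
  rw [this]
  apply Measurable.lintegral_prod_right' (f := fun p : En n × En n =>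
    if edist p.1 p.2 < E k then g p.2 else 0)
  apply Measurable.ite
  · exact measurableSet_lt (by fun_prop) measurable_const
  · fun_prop
  · fun_prop

/-- Dyadic-radius maximal function (normalised by powers of the radius). -/
def Mx {n : ℕ} (g : En n → ℝ≥0∞) (x : En n) : ℝ≥0∞ := ⨆ k : ℤ, E (-(k * n)) * S k g x

lemma measurable_Mx {n : ℕ} {g : En n → ℝ≥0∞} (hg : Measurable g) : Measurable (Mx g) :=
  Measurable.iSup fun k => (measurable_S k hg).const_mul _

lemma E_neg_mul_cancel (x : ℝ) : E x * E (-x) = 1 := by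
  rw [← E_add]; simp [E_zero]

lemma weak_type_aux {n : ℕ} (g : En n → ℝ≥0∞) (l : ℝ≥0∞) (K : ℤ) :
    l * volume {x | ∃ k : ℤ, k ≤ K ∧ l * E (k * n) < S k g x} ≤ 5 ^ n * vB n * ∫⁻ y, g y := by
  set T : Set (En n × ℤ) := {p | p.2 ≤ K ∧ l * E (p.2 * n) < S p.2 g p.1} with hT
  obtain ⟨u, hut, hdis, hcov⟩ :=
    Vitali.exists_disjoint_subfamily_covering_enlargement_closedBall T
      (fun p => p.1) (fun p => (2 : ℝ) ^ (p.2 : ℝ)) ((2 : ℝ) ^ (K : ℝ))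
      (by
        rintro p ⟨hp, -⟩
        apply Real.rpow_le_rpow_of_exponent_le (by norm_num)
        exact_mod_cast hp) 5 (by norm_num)
  have hcount : u.Countable := by
    apply hdis.countable_of_nonempty_interior
    intro p _
    refine ⟨p.1, ?_⟩
    apply Metric.ball_subset_interior_closedBall
    apply Metric.mem_ball_self
    positivity
  have hsub : {x | ∃ k : ℤ, k ≤ K ∧ l * E (k * n) < S k g x} ⊆
      ⋃ p ∈ u, Metric.closedBall p.1 (5 * (2 : ℝ) ^ (p.2 : ℝ)) := by
    rintro x ⟨k, hk, hx⟩
    obtain ⟨b, hb, hb'⟩ := hcov (x, k) ⟨hk, hx⟩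
    refine Set.mem_biUnion hb (hb' ?_)
    apply Metric.mem_closedBall_self
    positivity
  have hd2 : u.PairwiseDisjoint fun p => dB p.1 (p.2 : ℝ) := by
    intro p hp p' hp' hne
    refine (hdis hp hp' hne).mono ?_ ?_ <;>
    · simp only [dB_eq]
      exact Metric.ball_subset_closedBall
  calc l * volume {x | ∃ k : ℤ, k ≤ K ∧ l * E (k * n) < S k g x}
      ≤ l * ∑' p : u, volume (Metric.closedBall p.1.1 (5 * (2 : ℝ) ^ (p.1.2 : ℝ))) := by
        gcongr
        exact (measure_mono hsub).trans (measure_biUnion_le _ hcount _)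
    _ = 5 ^ n * vB n * ∑' p : u, l * E (p.1.2 * n) := by
        rw [← ENNReal.tsum_mul_left, ← ENNReal.tsum_mul_left]
        congr 1; ext p
        rw [Measure.addHaar_closedBall _ _ (by positivity), mul_pow,
          ENNReal.ofReal_mul (by positivity)]
        simp only [finrank_euclideanSpace, Fintype.card_fin]
        rw [two_pow_E, vB, ENNReal.ofReal_pow (by norm_num)]
        norm_num
        ring
    _ ≤ 5 ^ n * vB n * ∑' p : u, S p.1.2 g p.1.1 := by
        gcongr with p
        exact (hut p.2).2.le
    _ = 5 ^ n * vB n * ∫⁻ y in ⋃ p ∈ u, dB p.1 (p.2 : ℝ), g y := by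
        rw [lintegral_biUnion hcount (fun p _ => measurableSet_dB _ _) hd2]
        rfl
    _ ≤ _ := by
        exact mul_le_mul_right (setLIntegral_le_lintegral _ _) _

lemma weak_type {n : ℕ} (g : En n → ℝ≥0∞) (l : ℝ≥0∞) :
    l * volume {x | l < Mx g x} ≤ 5 ^ n * vB n * ∫⁻ y, g y := by
  have hset : {x | l < Mx g x} = ⋃ K : ℤ, {x | ∃ k : ℤ, k ≤ K ∧ l * E (k * n) < S k g x} := by
    ext x
    simp only [Set.mem_ofPred_eq, Mx, lt_iSup_iff, Set.mem_iUnion]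
    have key : ∀ k : ℤ, l < E (-(k * n)) * S k g x ↔ l * E (k * n) < S k g x := by
      intro k
      rw [← ENNReal.mul_lt_mul_iff_left (a := l) (E_ne_zero (k * n)) (E_ne_top (k * n)),
        mul_comm (E (-(k * n))), mul_assoc, mul_comm (E (-(k * n))), E_neg_mul_cancel, mul_one]
    constructor
    · rintro ⟨k, hk⟩; exact ⟨k, k, le_rfl, (key k).1 hk⟩
    · rintro ⟨K, k, _, hk⟩; exact ⟨k, (key k).2 hk⟩
  rw [hset, Monotone.measure_iUnion, ENNReal.mul_iSup]
  · exact iSup_le fun K => weak_type_aux g l K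
  · rintro K K' hK x ⟨k, hk, hx⟩
    exact ⟨k, hk.trans hK, hx⟩

lemma Mx_split {n : ℕ} {g : En n → ℝ≥0∞} (τ : ℝ≥0∞) (x : En n) :
    Mx g x ≤ τ * vB n + Mx (fun y => if τ < g y then g y else 0) x := by
  unfold Mx
  refine iSup_le fun k => ?_
  have h1 : S k g x ≤ τ * (E (k * n) * vB n) + S k (fun y => if τ < g y then g y else 0) x := by
    unfold S
    rw [← volume_dB x k, ← setLIntegral_const, ← lintegral_add_left measurable_const]
    refine lintegral_mono fun y => ?_
    dsimp only
    split_ifs with h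
    · exact le_add_self
    · simpa using not_lt.1 h
  calc E (-(k * n)) * S k g x
      ≤ E (-(k * n)) * (τ * (E (k * n) * vB n) + S k (fun y => if τ < g y then g y else 0) x) := by
        gcongr
    _ = (E (k * n) * E (-(k * n))) * (τ * vB n)
        + E (-(k * n)) * S k (fun y => if τ < g y then g y else 0) x := by ring
    _ ≤ _ := by
        rw [E_neg_mul_cancel, one_mul]
        gcongr
        exact le_iSup (fun k : ℤ => E (-(k * n)) * S k (fun y => if τ < g y then g y else 0) x) k

lemma strong_type (n : ℕ) {q : ℝ} (hq : 1 < q) :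
    ∃ C : ℝ≥0∞, C ≠ ∞ ∧ ∀ g : En n → ℝ≥0∞, Measurable g →
      ∫⁻ x, Mx g x ^ q ≤ C * ∫⁻ x, g x ^ q := by
  obtain ⟨C, hC, hsum⟩ := sum_lt (a := q - 1) (by linarith)
  obtain ⟨w, hw⟩ : ∃ w : ℝ, vB n ≤ E w := by
    rcases eq_or_ne (vB n) 0 with h | h
    · exact ⟨0, by rw [h]; exact zero_le⟩
    · obtain ⟨w, hw⟩ := exists_E h (vB_ne_top n)
      exact ⟨w, hw.le⟩
  set A : ℝ≥0∞ := 5 ^ n * vB n with hA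
  have hAt : A ≠ ∞ := ENNReal.mul_ne_top (by simp) (vB_ne_top n)
  refine ⟨A * E (q + 1) * C * E ((1 + w) * (q - 1)), ?_, fun g hg => ?_⟩
  · exact ENNReal.mul_ne_top (ENNReal.mul_ne_top (ENNReal.mul_ne_top hAt (E_ne_top _)) hC)
      (E_ne_top _)
  have hweak : ∀ k : ℤ, volume {x | E k < Mx g x} ≤
      E (1 - k) * (A * ∫⁻ y, if E (k - 1 - w) < g y then g y else 0) := by
    intro k
    have hsub : {x | E k < Mx g x} ⊆
        {x | E (k - 1) < Mx (fun y => if E (k - 1 - w) < g y then g y else 0) x} := by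
      intro x hx
      simp only [Set.mem_ofPred_eq] at hx ⊢
      by_contra hcon
      rw [not_lt] at hcon
      have h2 : E (k - 1 - w) * vB n ≤ E (k - 1) := by
        calc E (k - 1 - w) * vB n ≤ E (k - 1 - w) * E w := by gcongr
          _ = E (k - 1) := by rw [← E_add]; congr 1; ring
      have h3 := (hx.trans_le (Mx_split (g := g) (E (k - 1 - w)) x)).trans_le (add_le_add h2 hcon)
      have h4 : E (k - 1 : ℝ) + E (k - 1) = E k := by
        have : E (k : ℝ) = E (k - 1) * E 1 := by rw [← E_add]; congr 1; ring
        rw [this, E, E, ENNReal.rpow_one, mul_two]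
      rw [h4] at h3
      exact lt_irrefl _ h3
    refine (measure_mono hsub).trans ?_
    have := weak_type (fun y => if E (k - 1 - w) < g y then g y else 0) (E (k - 1))
    calc _ = E (1 - k) * (E (k - 1) * volume
          {x | E (k - 1) < Mx (fun y => if E (k - 1 - w) < g y then g y else 0) x}) := by
            rw [← mul_assoc, ← E_add]
            have : (1 - k + (k - 1) : ℝ) = 0 := by ring
            rw [this, E_zero, one_mul]
      _ ≤ _ := by gcongr
  calc ∫⁻ x, Mx g x ^ q
      ≤ ∫⁻ x, ∑' k : ℤ, (if E k < Mx g x then E ((k + 1) * q) else 0) :=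
        lintegral_mono fun x => rpow_le_dyadic (by linarith) _
    _ = ∑' k : ℤ, ∫⁻ x, (if E k < Mx g x then E ((k + 1) * q) else 0) := by
        apply lintegral_tsum
        intro k
        apply Measurable.aemeasurable
        exact Measurable.ite (measurableSet_lt measurable_const (measurable_Mx hg))
          measurable_const measurable_const
    _ = ∑' k : ℤ, E ((k + 1) * q) * volume {x | E k < Mx g x} := by
        congr 1; ext k
        rw [← lintegral_indicator_const (measurableSet_lt measurable_const (measurable_Mx hg))]
        congr 1; ext x
        simp [Set.indicator_apply]
    _ ≤ ∑' k : ℤ, E ((k + 1) * q) *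
          (E (1 - k) * (A * ∫⁻ y, if E (k - 1 - w) < g y then g y else 0)) := by
        gcongr with k
        exact hweak k
    _ = ∑' k : ℤ, A * E (q + 1) * ∫⁻ y,
          g y * (if E k < E (1 + w) * g y then E (k * (q - 1)) else 0) := by
        congr 1; ext k
        have e : ∀ y, g y * (if E k < E (1 + w) * g y then E (k * (q - 1)) else 0) =
            E (k * (q - 1)) * (if E (k - 1 - w) < g y then g y else 0) := by
          intro y
          have : E k < E (1 + w) * g y ↔ E (k - 1 - w) < g y := by
            rw [← ENNReal.mul_lt_mul_iff_right (E_ne_zero (1 + w)) (E_ne_top (1 + w))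
              (b := E (k - 1 - w)), ← E_add]
            have : (1 + w + (k - 1 - w) : ℝ) = k := by ring
            rw [this]
          simp only [this]
          split_ifs <;> ring
        simp_rw [e]
        rw [lintegral_const_mul]
        · have : E ((k + 1) * q) * E (1 - k) = E (q + 1) * E (k * (q - 1)) := by
            rw [← E_add, ← E_add]; congr 1; ring
          calc _ = (E ((k + 1) * q) * E (1 - k)) *
              (A * ∫⁻ y, if E (k - 1 - w) < g y then g y else 0) := by ring
            _ = _ := by rw [this]; ring
        · exact Measurable.ite (measurableSet_lt measurable_const hg) hg measurable_const
    _ = A * E (q + 1) * ∫⁻ y, g y *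
          ∑' k : ℤ, (if E k < E (1 + w) * g y then E (k * (q - 1)) else 0) := by
        rw [ENNReal.tsum_mul_left, ← lintegral_tsum]
        · simp_rw [ENNReal.tsum_mul_left]
        · intro k
          apply Measurable.aemeasurable
          exact hg.mul (Measurable.ite (measurableSet_lt measurable_const (hg.const_mul _))
            measurable_const measurable_const)
    _ ≤ A * E (q + 1) * ∫⁻ y, g y * (C * (E (1 + w) * g y) ^ (q - 1)) := by
        gcongr with y
        exact hsum _
    _ = A * E (q + 1) * ∫⁻ y, (C * E ((1 + w) * (q - 1))) * g y ^ q := by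
        congr 2; ext y
        rw [ENNReal.mul_rpow_of_nonneg _ _ (by linarith), E_rpow]
        have : g y ^ q = g y * g y ^ (q - 1) := by
          conv_rhs => rw [← ENNReal.rpow_one (g y), ← ENNReal.rpow_mul, one_mul]
          rw [← ENNReal.rpow_add_of_nonneg _ _ (by norm_num) (by linarith)]
          congr 1; ring
        rw [this]; ring
    _ = _ := by
        rw [lintegral_const_mul _ (hg.pow_const q)]; ring

/-- Dyadic model of the fractional integral. -/
def J {n : ℕ} (α : ℝ) (g : En n → ℝ≥0∞) (x : En n) : ℝ≥0∞ :=
  ∑' k : ℤ, E (-(k * (n - α))) * S k g x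

lemma measurable_J {n : ℕ} (α : ℝ) {g : En n → ℝ≥0∞} (hg : Measurable g) :
    Measurable (J α g) :=
  Measurable.ennreal_tsum fun k => (measurable_S k hg).const_mul _

lemma frac_le_J {n : ℕ} {α : ℝ} (hα : 0 < α) (hαn : α < n) {g : En n → ℝ≥0∞}
    (hg : Measurable g) (x : En n) : fracIntegral α g x ≤ E (n - α) * J α g x := by
  have hn : 0 < n := by
    have : (0 : ℝ) < n := hα.trans hαn
    exact_mod_cast this
  have : Nonempty (Fin n) := ⟨⟨0, hn⟩⟩
  have : Nontrivial (En n) := inferInstance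
  have hβ : 0 < (n : ℝ) - α := by linarith
  unfold fracIntegral J
  have hpt : ∀ᵐ y : En n, g y / edist x y ^ ((n : ℝ) - α) ≤
      ∑' k : ℤ, E (n - α) * E (-(k * (n - α))) * (if edist x y < E k then g y else 0) := by
    have : ∀ᵐ y : En n, y ≠ x := by
      simp [ae_iff, measure_singleton]
    filter_upwards [this] with y hy
    obtain ⟨j, hj1, hj2⟩ := exists_dyadic_Ico (u := edist x y)
      (fun h => hy.symm (edist_eq_zero.1 h)) (edist_ne_top _ _)
    refine le_trans ?_ (ENNReal.le_tsum (j + 1))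
    push_cast
    rw [if_pos hj2, ENNReal.div_eq_inv_mul, ← E_add]
    gcongr
    have e1 : E ((n : ℝ) - α + -((j + 1) * (n - α))) = (E (j * (n - α)))⁻¹ := by
      apply ENNReal.eq_inv_of_mul_eq_one_left
      rw [← E_add, ← E_zero]; congr 1; ring
    rw [e1, ← E_rpow]
    gcongr
  refine (lintegral_mono_ae hpt).trans ?_
  rw [lintegral_tsum, ← ENNReal.tsum_mul_left]
  · refine ENNReal.tsum_le_tsum fun k => ?_
    rw [lintegral_const_mul, S_eq, mul_assoc]
    exact Measurable.ite (measurableSet_lt (by fun_prop) measurable_const) hg measurable_const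
  · intro k
    apply Measurable.aemeasurable
    apply Measurable.const_mul
    exact Measurable.ite (measurableSet_lt (by fun_prop) measurable_const) hg measurable_const

lemma holder_set {n : ℕ} {q : ℝ} (hq : 1 < q) {g : En n → ℝ≥0∞} (hg : Measurable g)
    (A : Set (En n)) :
    ∫⁻ y in A, g y ≤ volume A ^ (1 - 1 / q) * (∫⁻ y in A, g y ^ q) ^ (1 / q) := by
  have hc := Real.HolderConjugate.conjExponent hq
  have := ENNReal.lintegral_mul_le_Lp_mul_Lq (volume.restrict A) hc.symm
    (f := fun _ => 1) (g := g) aemeasurable_const hg.aemeasurable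
  simp only [Pi.mul_apply, one_mul, ENNReal.one_rpow, lintegral_one, Measure.restrict_apply,
    MeasurableSet.univ, Set.univ_inter] at this
  have e : 1 / q.conjExponent = 1 - 1 / q := by
    rw [one_div, one_div]; exact hc.one_sub_inv.symm
  rwa [e] at this

lemma cube_volume {n : ℕ} (c : En n) (ρ : ℝ) :
    volume (cube c ((2 : ℝ) ^ ρ)) = E ((1 + ρ) * n) := by
  have h : cube c ((2 : ℝ) ^ ρ) = (@WithLp.ofLp 2 (Fin n → ℝ)) ⁻¹'
      (Set.pi Set.univ fun i => Set.Ioo (c i - 2 ^ ρ) (c i + 2 ^ ρ)) := by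
    ext y
    simp only [cube, Set.mem_ofPred_eq, Set.mem_preimage, Set.mem_pi, Set.mem_univ, true_imp_iff,
      Set.mem_Ioo, abs_lt]
    refine forall_congr' fun i => ?_
    constructor <;> rintro ⟨h1, h2⟩ <;> constructor <;> linarith
  rw [h, (PiLp.volume_preserving_ofLp (Fin n)).measure_preimage
    (MeasurableSet.univ_pi fun i => measurableSet_Ioo).nullMeasurableSet, Real.volume_pi_Ioo]
  have : ∀ i : Fin n, ENNReal.ofReal (c i + 2 ^ ρ - (c i - 2 ^ ρ)) = E (1 + ρ) := by
    intro i
    rw [E_ofReal, Real.rpow_add (by norm_num), Real.rpow_one]; congr 1; ring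
  simp only [this, Finset.prod_const, Finset.card_univ, Fintype.card_fin]
  rw [← E_rpow, ENNReal.rpow_natCast]

lemma measurableSet_cube {n : ℕ} (c : En n) (r : ℝ) : MeasurableSet (cube c r) := by
  have : cube c r = ⋂ i, {y : En n | |y i - c i| < r} := by
    ext y; simp [cube]
  rw [this]
  refine MeasurableSet.iInter fun i => measurableSet_lt (by fun_prop) measurable_const

lemma dB_coord {n : ℕ} {x y : En n} {k : ℝ} (h : y ∈ dB x k) (i : Fin n) :
    |y i - x i| < (2 : ℝ) ^ k := by
  rw [dB_eq, Metric.mem_ball, dist_eq_norm] at h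
  refine lt_of_le_of_lt ?_ h
  have := PiLp.norm_apply_le (y - x) i
  simpa using this

lemma morrey_bound {n : ℕ} (p q : ℝ) (g : En n → ℝ≥0∞) (c : En n) (ρ : ℝ) :
    (∫⁻ y in cube c ((2 : ℝ) ^ ρ), g y ^ q) ^ (1 / q) ≤
      E ((1 + ρ) * n * (1 / q - 1 / p)) * morreyNormE p q g := by
  have h : volume (cube c ((2 : ℝ) ^ ρ)) ^ (1 / p - 1 / q) *
      (∫⁻ y in cube c ((2 : ℝ) ^ ρ), g y ^ q) ^ (1 / q) ≤ morreyNormE p q g := by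
    unfold morreyNormE
    exact le_iSup_of_le c (le_iSup_of_le ((2 : ℝ) ^ ρ) (le_iSup_of_le (by positivity) le_rfl))
  rw [cube_volume, E_rpow] at h
  calc _ = E ((1 + ρ) * n * (1 / q - 1 / p)) * (E ((1 + ρ) * n * (1 / p - 1 / q)) *
        (∫⁻ y in cube c ((2 : ℝ) ^ ρ), g y ^ q) ^ (1 / q)) := by
        rw [← mul_assoc, ← E_add]
        have : (1 + ρ) * n * (1 / q - 1 / p) + (1 + ρ) * n * (1 / p - 1 / q) = 0 := by ring
        rw [this, E_zero, one_mul]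
    _ ≤ _ := by gcongr

/-- Hardy–Littlewood–Sobolev for the dyadic model. -/
lemma hls {n : ℕ} {α q t : ℝ} (hα : 0 < α) (hαn : α < n) (hq : 1 < q) (ht : 1 < t)
    (htq : 1 / t = 1 / q - α / n) :
    ∃ C : ℝ≥0∞, C ≠ ∞ ∧ ∀ g : En n → ℝ≥0∞, Measurable g →
      (∫⁻ x, J α g x ^ t) ^ (1 / t) ≤ C * (∫⁻ x, g x ^ q) ^ (1 / q) := by
  have hn : (0 : ℝ) < n := hα.trans hαn
  have hb : 0 < n / t := by positivity
  obtain ⟨C1, hC1, hmin⟩ := min_sum hα hb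
  obtain ⟨C2, hC2, hM⟩ := strong_type n hq
  have hsum : α + n / t = n / q := by
    have : (n : ℝ) / t = n * (1 / t) := by ring
    rw [this, htq]; field_simp; ring
  have e1 : n / t / (α + n / t) = q / t := by rw [hsum]; field_simp
  have e2 : α / (α + n / t) = 1 - q / t := by
    rw [← e1]; field_simp; ring
  have hlt : q < t := by
    have h1 : 1 / t < 1 / q := by rw [htq]; have : 0 < α / n := by positivity
                                  linarith
    exact (one_div_lt_one_div (by linarith) (by linarith)).1 h1
  have hqt : 0 < 1 - q / t := by rw [← e2]; positivity
  set V := vB n ^ (1 - 1 / q) with hV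
  have hq1 : 0 ≤ 1 - 1 / q := by
    have : 1 / q ≤ 1 := by rw [div_le_one (by linarith)]; linarith
    linarith
  have hVt : V ≠ ∞ := ENNReal.rpow_ne_top_of_nonneg hq1 (vB_ne_top n)
  have ht0 : 0 < t := by linarith
  refine ⟨C1 * V ^ (1 - q / t) * C2 ^ (1 / t), ?_, fun g hg => ?_⟩
  · exact ENNReal.mul_ne_top (ENNReal.mul_ne_top hC1 (ENNReal.rpow_ne_top_of_nonneg hqt.le hVt))
      (ENNReal.rpow_ne_top_of_nonneg (by positivity) hC2)
  set F := (∫⁻ x, g x ^ q) ^ (1 / q) with hF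
  have hFq : ∫⁻ x, g x ^ q = F ^ q := by
    rw [hF, ← ENNReal.rpow_mul]
    have : 1 / q * q = 1 := by field_simp
    rw [this, ENNReal.rpow_one]
  have hpt : ∀ x, J α g x ≤ (C1 * V ^ (1 - q / t) * F ^ (1 - q / t)) * Mx g x ^ (q / t) := by
    intro x
    have h := hmin (Mx g x) (V * F)
    rw [e1, e2, ENNReal.mul_rpow_of_nonneg _ _ hqt.le] at h
    refine le_trans (ENNReal.tsum_le_tsum fun k => ?_) (h.trans (le_of_eq (by ring)))
    refine le_min ?_ ?_
    · have h1 : E (-(k * n)) * S k g x ≤ Mx g x :=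
        le_iSup (fun k : ℤ => E (-(k * n)) * S k g x) k
      calc E (-(k * (n - α))) * S k g x = E (k * α) * (E (-(k * n)) * S k g x) := by
            rw [← mul_assoc, ← E_add]; congr 2; ring
        _ ≤ _ := by gcongr
    · have h1 : S k g x ≤ E (k * n * (1 - 1 / q)) * (V * F) := by
        refine (holder_set hq hg (dB x k)).trans ?_
        rw [volume_dB, ENNReal.mul_rpow_of_nonneg _ _ hq1, E_rpow, mul_assoc]
        gcongr
        rw [hF]
        exact ENNReal.rpow_le_rpow (setLIntegral_le_lintegral _ _) (by positivity)
      calc E (-(k * (n - α))) * S k g x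
          ≤ E (-(k * (n - α))) * (E (k * n * (1 - 1 / q)) * (V * F)) := by gcongr
        _ = E (-(k * (n / t))) * (V * F) := by
            rw [← mul_assoc, ← E_add]
            congr 2
            have : (n : ℝ) / t = n / q - α := by linarith
            rw [this]; ring
  obtain ⟨K, hK⟩ : ∃ K, K = C1 * V ^ (1 - q / t) * F ^ (1 - q / t) := ⟨_, rfl⟩
  simp only [← hK] at hpt
  calc (∫⁻ x, J α g x ^ t) ^ (1 / t)
      ≤ (∫⁻ x, K ^ t * Mx g x ^ q) ^ (1 / t) := by
        refine ENNReal.rpow_le_rpow (lintegral_mono fun x => ?_) (by positivity)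
        calc J α g x ^ t ≤ (K * Mx g x ^ (q / t)) ^ t :=
              ENNReal.rpow_le_rpow (hpt x) ht0.le
          _ = K ^ t * Mx g x ^ q := by
              rw [ENNReal.mul_rpow_of_nonneg _ _ ht0.le, ← ENNReal.rpow_mul]
              congr 2; field_simp
    _ = (K ^ t * ∫⁻ x, Mx g x ^ q) ^ (1 / t) := by
        rw [lintegral_const_mul _ ((measurable_Mx hg).pow_const q)]
    _ ≤ (K ^ t * (C2 * F ^ q)) ^ (1 / t) := by
        refine ENNReal.rpow_le_rpow ?_ (by positivity)
        gcongr
        rw [← hFq]; exact hM g hg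
    _ = K * (C2 ^ (1 / t) * F ^ (q / t)) := by
        rw [ENNReal.mul_rpow_of_nonneg _ _ (by positivity),
          ENNReal.mul_rpow_of_nonneg _ _ (by positivity), ← ENNReal.rpow_mul, ← ENNReal.rpow_mul]
        have : t * (1 / t) = 1 := by field_simp
        rw [this, ENNReal.rpow_one, mul_one_div]
    _ = C1 * V ^ (1 - q / t) * C2 ^ (1 / t) * (F ^ (1 - q / t) * F ^ (q / t)) := by
        rw [hK]; ring
    _ = _ := by
        rw [← ENNReal.rpow_add_of_nonneg _ _ hqt.le (by positivity), sub_add_cancel,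
          ENNReal.rpow_one]

lemma far_part {n : ℕ} {α p q s : ℝ} (hα : 0 < α) (hαn : α < n) (hq : 1 < q) (hs0 : 0 < s)
    (hs : 1 / s = 1 / p - α / n) :
    ∃ C : ℝ≥0∞, C ≠ ∞ ∧ ∀ g : En n → ℝ≥0∞, Measurable g → ∀ (x : En n) (ρ : ℝ),
      ∑' k : ℤ, (if ρ < (k : ℝ) then E (-(k * (n - α))) * S k g x else 0) ≤
        C * E (-(ρ * (n / s))) * morreyNormE p q g := by
  have hn : (0 : ℝ) < n := hα.trans hαn
  have hb : 0 < n / s := by positivity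
  obtain ⟨C, hC, h⟩ := sum_gt hb
  refine ⟨E (n * (1 - 1 / p)) * C, ENNReal.mul_ne_top (E_ne_top _) hC, fun g hg x ρ => ?_⟩
  set N := morreyNormE p q g with hN
  calc _ ≤ ∑' k : ℤ, (E (n * (1 - 1 / p)) * N) *
        (if ρ < (k : ℝ) then E (-(k * (n / s))) else 0) := by
        refine ENNReal.tsum_le_tsum fun k => ?_
        split_ifs with hk
        · have h1 : S k g x ≤ E ((1 + k) * n * (1 - 1 / p)) * N := by
            have hsub : dB x (k : ℝ) ⊆ cube x ((2 : ℝ) ^ (k : ℝ)) := fun y hy i => dB_coord hy i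
            calc S k g x ≤ ∫⁻ y in cube x ((2 : ℝ) ^ (k : ℝ)), g y := lintegral_mono_set hsub
              _ ≤ _ := holder_set hq hg _
              _ ≤ E ((1 + k) * n * (1 - 1 / q)) * (E ((1 + k) * n * (1 / q - 1 / p)) * N) := by
                  rw [cube_volume, E_rpow]
                  gcongr
                  exact morrey_bound p q g x k
              _ = _ := by rw [← mul_assoc, ← E_add]; congr 2; ring
          calc _ ≤ E (-(k * (n - α))) * (E ((1 + k) * n * (1 - 1 / p)) * N) := by gcongr
            _ = (E (-(k * (n - α))) * E ((1 + k) * n * (1 - 1 / p))) * N := by ring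
            _ = (E (n * (1 - 1 / p)) * E (-(k * (n / s)))) * N := by
                rw [← E_add, ← E_add]
                congr 2
                have : (n : ℝ) / s = n * (1 / s) := by ring
                rw [this, hs]; field_simp; ring
            _ = _ := by ring
        · exact zero_le
    _ ≤ (E (n * (1 - 1 / p)) * N) * (C * E (-(ρ * (n / s)))) := by
        rw [ENNReal.tsum_mul_left]
        gcongr
        exact h ρ
    _ = _ := by ring

lemma J_split {n : ℕ} (α : ℝ) (g : En n → ℝ≥0∞) (c x : En n) (ρ : ℝ)
    (hx : x ∈ cube c ((2 : ℝ) ^ ρ)) :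
    J α g x ≤ J α ((cube c ((2 : ℝ) ^ (ρ + 1))).indicator g) x +
      ∑' k : ℤ, (if ρ < (k : ℝ) then E (-(k * (n - α))) * S k g x else 0) := by
  unfold J
  rw [← ENNReal.tsum_add]
  refine ENNReal.tsum_le_tsum fun k => ?_
  split_ifs with hk
  · exact le_add_self
  · rw [add_zero]
    gcongr
    unfold S
    refine setLIntegral_mono' (measurableSet_dB x k) fun y hy => ?_
    rw [Set.indicator_of_mem]
    intro i
    have h1 := dB_coord hy i
    have h2 : |x i - c i| < (2 : ℝ) ^ ρ := hx i
    have h3 : (2 : ℝ) ^ (k : ℝ) ≤ 2 ^ ρ :=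
      Real.rpow_le_rpow_of_exponent_le (by norm_num) (not_lt.1 hk)
    have h4 : (2 : ℝ) ^ (ρ + 1) = 2 ^ ρ + 2 ^ ρ := by
      rw [Real.rpow_add (by norm_num), Real.rpow_one]; ring
    have h5 := abs_sub_le (y i) (x i) (c i)
    rw [h4]; linarith

lemma peetre_core {n : ℕ} {α p q s t : ℝ}
    (hα : 0 < α) (hαn : α < n) (hq : 1 < q) (ht : 1 < t) (hs0 : 0 < s)
    (hs : 1 / s = 1 / p - α / n) (htq : 1 / t = 1 / q - α / n) :
    ∃ C : ℝ≥0∞, C ≠ ∞ ∧ ∀ g : En n → ℝ≥0∞, Measurable g →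
      morreyNormE s t (fracIntegral α g) ≤ C * morreyNormE p q g := by
  obtain ⟨C1, hC1, h1⟩ := hls (n := n) hα hαn hq ht htq
  obtain ⟨C2, hC2, h2⟩ := far_part (n := n) (q := q) hα hαn hq hs0 hs
  have ht0 : 0 < t := by linarith
  refine ⟨E (n - α) * (C1 * E (n * (1 / q - 1 / p)) + C2 * E (n / s)), ?_, fun g hg => ?_⟩
  · exact ENNReal.mul_ne_top (E_ne_top _) (ENNReal.add_ne_top.2
      ⟨ENNReal.mul_ne_top hC1 (E_ne_top _), ENNReal.mul_ne_top hC2 (E_ne_top _)⟩)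
  set N := morreyNormE p q g with hN
  refine iSup_le fun c => iSup_le fun r => iSup_le fun hr => ?_
  obtain ⟨ρ, rfl⟩ : ∃ ρ : ℝ, r = (2 : ℝ) ^ ρ :=
    ⟨Real.logb 2 r, (Real.rpow_logb (by norm_num) (by norm_num) hr).symm⟩
  set Q := cube c ((2 : ℝ) ^ ρ) with hQ
  set g1 := (cube c ((2 : ℝ) ^ (ρ + 1))).indicator g with hg1
  have hg1m : Measurable g1 := hg.indicator (measurableSet_cube _ _)
  set B := C2 * E (-(ρ * (n / s))) * N with hB
  have hF : (∫⁻ x, g1 x ^ q) ^ (1 / q) ≤ E ((2 + ρ) * n * (1 / q - 1 / p)) * N := by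
    have e : ∫⁻ x, g1 x ^ q = ∫⁻ x in cube c ((2 : ℝ) ^ (ρ + 1)), g x ^ q := by
      rw [← lintegral_indicator (measurableSet_cube _ _)]
      congr 1; ext x
      simp only [hg1]
      by_cases hx : x ∈ cube c ((2 : ℝ) ^ (ρ + 1))
      · rw [Set.indicator_of_mem hx, Set.indicator_of_mem hx]
      · rw [Set.indicator_of_notMem hx, Set.indicator_of_notMem hx,
          ENNReal.zero_rpow_of_pos (by linarith)]
    rw [e]
    refine (morrey_bound p q g c (ρ + 1)).trans (le_of_eq ?_)
    rw [← hN]; congr 2; ring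
  have hint : (∫⁻ x in Q, fracIntegral α g x ^ t) ^ (1 / t) ≤
      E (n - α) * (C1 * (E ((2 + ρ) * n * (1 / q - 1 / p)) * N) + B * E ((1 + ρ) * n * (1 / t))) := by
    calc (∫⁻ x in Q, fracIntegral α g x ^ t) ^ (1 / t)
        ≤ (∫⁻ x in Q, E (n - α) ^ t * (J α g1 x + B) ^ t) ^ (1 / t) := by
          refine ENNReal.rpow_le_rpow (setLIntegral_mono' (measurableSet_cube _ _)
            fun x hx => ?_) (by positivity)
          rw [← ENNReal.mul_rpow_of_nonneg _ _ ht0.le]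
          refine ENNReal.rpow_le_rpow ?_ ht0.le
          refine (frac_le_J hα hαn hg x).trans ?_
          gcongr
          refine (J_split α g c x ρ hx).trans ?_
          gcongr
          exact h2 g hg x ρ
      _ = E (n - α) * (∫⁻ x in Q, (J α g1 x + B) ^ t) ^ (1 / t) := by
          rw [lintegral_const_mul _ (((measurable_J α hg1m).add_const B).pow_const t),
            ENNReal.mul_rpow_of_nonneg _ _ (by positivity), ← ENNReal.rpow_mul]
          have : t * (1 / t) = 1 := by field_simp
          rw [this, ENNReal.rpow_one]
      _ ≤ E (n - α) * ((∫⁻ x in Q, J α g1 x ^ t) ^ (1 / t) + (∫⁻ x in Q, B ^ t) ^ (1 / t)) := by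
          gcongr
          exact ENNReal.lintegral_Lp_add_le (measurable_J α hg1m).aemeasurable
            aemeasurable_const ht.le
      _ ≤ _ := by
          gcongr
          · calc (∫⁻ x in Q, J α g1 x ^ t) ^ (1 / t) ≤ (∫⁻ x, J α g1 x ^ t) ^ (1 / t) :=
                  ENNReal.rpow_le_rpow (setLIntegral_le_lintegral _ _) (by positivity)
              _ ≤ C1 * (∫⁻ x, g1 x ^ q) ^ (1 / q) := h1 g1 hg1m
              _ ≤ _ := by gcongr
          · rw [setLIntegral_const, hQ, cube_volume,
              ENNReal.mul_rpow_of_nonneg _ _ (by positivity), ← ENNReal.rpow_mul, E_rpow]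
            have : t * (1 / t) = 1 := by field_simp
            rw [this, ENNReal.rpow_one]
  rw [hQ, cube_volume, E_rpow, ← hQ]
  have k1 : E ((1 + ρ) * n * (1 / s - 1 / t)) * E ((2 + ρ) * n * (1 / q - 1 / p)) =
      E (n * (1 / q - 1 / p)) := by
    rw [← E_add]; congr 1
    rw [hs, htq]; ring
  have k2 : E ((1 + ρ) * n * (1 / s - 1 / t)) * (E (-(ρ * (n / s))) * E ((1 + ρ) * n * (1 / t))) =
      E (n / s) := by
    rw [← E_add, ← E_add]; congr 1; ring
  calc _ ≤ E ((1 + ρ) * n * (1 / s - 1 / t)) * (E (n - α) *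
        (C1 * (E ((2 + ρ) * n * (1 / q - 1 / p)) * N) + B * E ((1 + ρ) * n * (1 / t)))) := by
        gcongr
    _ = E (n - α) * (C1 * (E ((1 + ρ) * n * (1 / s - 1 / t)) *
          E ((2 + ρ) * n * (1 / q - 1 / p))) + C2 * (E ((1 + ρ) * n * (1 / s - 1 / t)) *
            (E (-(ρ * (n / s))) * E ((1 + ρ) * n * (1 / t))))) * N := by
        rw [hB]; ring
    _ = _ := by rw [k1, k2]

/-- Peetre: For `0 < α < n`, `1 < q ≤ p < ∞`, `1 < t ≤ s < ∞` with
`1/s = 1/p - α/n` and `1/t = 1/q - α/n`, one has `‖I_α f‖_{M^s_t} ≤ C ‖f‖_{M^p_q}` for all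
nonnegative measurable `f`, with `C` depending only on `n, α, p, q`. -/
theorem peetre_fracIntegral_morrey (n : ℕ) (α p q s t : ℝ)
    (hα : 0 < α) (hαn : α < n) (hq : 1 < q) (hqp : q ≤ p) (ht : 1 < t) (hts : t ≤ s)
    (hs : 1 / s = 1 / p - α / n) (htq : 1 / t = 1 / q - α / n) :
    ∃ C : ℝ, 0 < C ∧
      ∀ f : En n → ℝ, Measurable f → (∀ x, 0 ≤ f x) →
        morreyNormE s t (fracIntegral α (fun y => ENNReal.ofReal (f y))) ≤
          ENNReal.ofReal C * morreyNormE p q (fun y => ENNReal.ofReal (f y)) := by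
  obtain ⟨C, hC, h⟩ := peetre_core (n := n) (p := p) hα hαn hq ht (by linarith) hs htq
  refine ⟨C.toReal + 1, by positivity, fun f hf _ => ?_⟩
  refine (h _ hf.ennreal_ofReal).trans ?_
  gcongr
  calc C = ENNReal.ofReal C.toReal := (ENNReal.ofReal_toReal hC).symm
    _ ≤ _ := ENNReal.ofReal_le_ofReal (by linarith)
end
end

section
/- Let 1 ≤ q₁ < q₂ < p < ∞. Then there is a constant C, depending only on q₁, q₂, p, such that for every measurable function f on ℝⁿ, ‖f‖_{M^p_{q₁}} ≤ C ‖f‖_{WM^p_{q₂}} ≤ C ‖f‖_{M^p_{q₂}} ≤ C ‖f‖_{L^{p,∞}} (chain of inequalities, with a common constant C). -/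
open MeasureTheory ENNReal

noncomputable section

lemma aux_int_low {q T : ℝ} (hq : 0 < q) (hT : 0 < T) :
    ∫⁻ t in Set.Ioc 0 T, ENNReal.ofReal (t ^ (q - 1)) = ENNReal.ofReal (T ^ q / q) := by
  have hi : IntervalIntegrable (fun x : ℝ => x ^ (q - 1)) volume 0 T :=
    intervalIntegral.intervalIntegrable_rpow' (by linarith)
  rw [← ofReal_integral_eq_lintegral_ofReal
    ((intervalIntegrable_iff_integrableOn_Ioc_of_le hT.le).1 hi)]
  · rw [← intervalIntegral.integral_of_le hT.le, integral_rpow (Or.inl (by linarith))]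
    simp [Real.zero_rpow hq.ne']
  · filter_upwards [ae_restrict_mem measurableSet_Ioc] with t ht
    exact Real.rpow_nonneg ht.1.le _

lemma aux_int_high {q s T : ℝ} (hqs : q < s) (hT : 0 < T) :
    ∫⁻ t in Set.Ioi T, ENNReal.ofReal (t ^ (q - 1 - s)) =
      ENNReal.ofReal (T ^ (q - s) / (s - q)) := by
  rw [← ofReal_integral_eq_lintegral_ofReal
    (integrableOn_Ioi_rpow_of_lt (by linarith) hT)]
  · rw [integral_Ioi_rpow_of_lt (by linarith) hT]
    congr 1
    rw [show q - 1 - s + 1 = q - s by ring, ← neg_sub s q, neg_div_neg_eq]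
  · filter_upwards [ae_restrict_mem measurableSet_Ioi] with t ht
    exact Real.rpow_nonneg (hT.trans ht).le _

lemma aux_real {q s a m : ℝ} (hq : 0 < q) (hqs : q < s) (ha : 0 < a) (hm : 0 < m) :
    q * (m * ((a * m ^ (-(1 / s))) ^ q / q) + a ^ s * ((a * m ^ (-(1 / s))) ^ (q - s) / (s - q)))
      = s / (s - q) * m ^ (1 - q / s) * a ^ q := by
  have hs : 0 < s := hq.trans hqs
  have hsq : s - q ≠ 0 := by linarith
  have h1 : m * (a * m ^ (-(1 / s))) ^ q = a ^ q * m ^ (1 - q / s) := by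
    rw [Real.mul_rpow ha.le (by positivity), ← Real.rpow_mul hm.le, sub_eq_add_neg,
      Real.rpow_add hm, Real.rpow_one, show -(1 / s) * q = -(q / s) by ring]
    ring
  have h2 : a ^ s * (a * m ^ (-(1 / s))) ^ (q - s) = a ^ q * m ^ (1 - q / s) := by
    rw [Real.mul_rpow ha.le (by positivity), ← Real.rpow_mul hm.le, ← mul_assoc,
      ← Real.rpow_add ha]
    congr 2
    · ring
    · field_simp
      ring
  calc _ = m * (a * m ^ (-(1 / s))) ^ q
        + q / (s - q) * (a ^ s * (a * m ^ (-(1 / s))) ^ (q - s)) := by field_simp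
    _ = _ := by
      rw [h1, h2]
      field_simp
      ring

lemma aux_key {α : Type*} [MeasurableSpace α] (μ : Measure α) (g : α → ℝ)
    (hg0 : ∀ x, 0 ≤ g x) (hg : Measurable g) {q s : ℝ} (hq : 0 < q) (hqs : q < s)
    (hm0 : μ Set.univ ≠ 0) (hmt : μ Set.univ ≠ ∞) (A : ℝ≥0∞)
    (H : ∀ t : ℝ, 0 < t → ENNReal.ofReal t ^ s * μ {x | t < g x} ≤ A ^ s) :
    ∫⁻ x, ENNReal.ofReal (g x ^ q) ∂μ ≤
      ENNReal.ofReal (s / (s - q)) * μ Set.univ ^ (1 - q / s) * A ^ q := by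
  have hs : 0 < s := hq.trans hqs
  have hsq : 0 < s - q := by linarith
  have hK : 0 < s / (s - q) := div_pos hs hsq
  rcases eq_or_ne A ∞ with rfl | hAt
  · rw [ENNReal.top_rpow_of_pos hq, ENNReal.mul_top]
    · exact le_top
    · refine mul_ne_zero (by simpa using hK) ?_
      simp [ENNReal.rpow_eq_zero_iff, hm0, hmt]
  rw [lintegral_rpow_eq_lintegral_meas_lt_mul μ (ae_of_all _ hg0) hg.aemeasurable hq]
  rcases eq_or_ne A 0 with rfl | hA0
  · have : ∫⁻ t in Set.Ioi (0:ℝ), μ {a : α | t < g a} * ENNReal.ofReal (t ^ (q - 1)) = 0 := by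
      rw [← lintegral_zero (μ := volume.restrict (Set.Ioi (0:ℝ)))]
      refine setLIntegral_congr_fun measurableSet_Ioi fun t ht => ?_
      have h := H t ht
      rw [ENNReal.zero_rpow_of_pos hs, nonpos_iff_eq_zero, mul_eq_zero] at h
      rcases h with h | h
      · exfalso
        have ht' : 0 < t := ht
        simp [ENNReal.rpow_eq_zero_iff, hs.not_gt] at h
        linarith [h.1]
      · simp [h]
    rw [this]; simp
  obtain ⟨a, ha, rfl⟩ : ∃ a : ℝ, 0 < a ∧ A = ENNReal.ofReal a :=
    ⟨A.toReal, ENNReal.toReal_pos hA0 hAt, (ENNReal.ofReal_toReal hAt).symm⟩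
  obtain ⟨m, hm, hmm⟩ : ∃ m : ℝ, 0 < m ∧ μ Set.univ = ENNReal.ofReal m :=
    ⟨_, ENNReal.toReal_pos hm0 hmt, (ENNReal.ofReal_toReal hmt).symm⟩
  set T := a * m ^ (-(1 / s)) with hTdef
  have hT : 0 < T := by positivity
  have hlow : ∫⁻ t in Set.Ioc 0 T, μ {a : α | t < g a} * ENNReal.ofReal (t ^ (q - 1)) ≤
      ENNReal.ofReal m * ENNReal.ofReal (T ^ q / q) := by
    rw [← aux_int_low hq hT, ← lintegral_const_mul' _ _ ENNReal.ofReal_ne_top]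
    refine lintegral_mono fun t => ?_
    rw [← hmm]
    exact mul_le_mul_left (measure_mono (Set.subset_univ _)) _
  have hhigh : ∫⁻ t in Set.Ioi T, μ {a : α | t < g a} * ENNReal.ofReal (t ^ (q - 1)) ≤
      ENNReal.ofReal (a ^ s) * ENNReal.ofReal (T ^ (q - s) / (s - q)) := by
    rw [← aux_int_high hqs hT, ← lintegral_const_mul' _ _ ENNReal.ofReal_ne_top]
    refine setLIntegral_mono' measurableSet_Ioi fun t ht => ?_
    have ht0 : 0 < t := hT.trans ht
    have h := H t ht0
    rw [ENNReal.ofReal_rpow_of_pos ht0, ENNReal.ofReal_rpow_of_pos ha] at h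
    have e : t ^ (q - 1) = t ^ s * t ^ (q - 1 - s) := by
      rw [← Real.rpow_add ht0]; congr 1; ring
    rw [e, ENNReal.ofReal_mul (by positivity), ← mul_assoc, mul_comm (μ _)]
    exact mul_le_mul_left h _
  rw [← Set.Ioc_union_Ioi_eq_Ioi hT.le,
    lintegral_union measurableSet_Ioi (Set.Ioc_disjoint_Ioi le_rfl)]
  refine (mul_le_mul_right (add_le_add hlow hhigh) _).trans ?_
  rw [hmm, ENNReal.ofReal_rpow_of_pos hm, ENNReal.ofReal_rpow_of_pos ha,
    ← ENNReal.ofReal_mul hm.le, ← ENNReal.ofReal_mul (by positivity),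
    ← ENNReal.ofReal_add (by positivity) (by positivity), ← ENNReal.ofReal_mul hq.le,
    ← ENNReal.ofReal_mul hK.le, ← ENNReal.ofReal_mul (by positivity),
    aux_real hq hqs ha hm]

lemma cube_isOpen {n : ℕ} (c : En n) (r : ℝ) : IsOpen (cube c r) := by
  have : cube c r = ⋂ i, {y : En n | |y i - c i| < r} := by
    ext y; simp [cube]
  rw [this]
  exact isOpen_iInter_of_finite fun i => isOpen_lt (by fun_prop) continuous_const

lemma cube_vol_ne_zero {n : ℕ} (c : En n) {r : ℝ} (hr : 0 < r) : volume (cube c r) ≠ 0 :=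
  ((cube_isOpen c r).measure_pos volume ⟨c, fun i => by simpa using hr⟩).ne'

lemma cube_vol_ne_top {n : ℕ} (c : En n) {r : ℝ} (hr : 0 < r) : volume (cube c r) ≠ ∞ := by
  have hsub : cube c r ⊆ Metric.closedBall c (Real.sqrt (∑ _i : Fin n, r ^ 2)) := by
    intro y hy
    rw [Metric.mem_closedBall, EuclideanSpace.dist_eq]
    refine Real.sqrt_le_sqrt (Finset.sum_le_sum fun i _ => ?_)
    rw [Real.dist_eq]
    exact pow_le_pow_left₀ (abs_nonneg _) (hy i).le 2
  exact ((measure_mono hsub).trans_lt measure_closedBall_lt_top).ne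

/-- On a cube: the strong `q` average is controlled by any weak `s` bound `A`. -/
lemma aux_cube {n : ℕ} (f : En n → ℂ) (hf : Measurable f) {p q s : ℝ} (hq : 0 < q) (hqs : q < s)
    (c : En n) {r : ℝ} (hr : 0 < r) (A : ℝ≥0∞)
    (H : ∀ t : ℝ, 0 < t → ENNReal.ofReal t ^ s * volume {y ∈ cube c r | t < ‖f y‖} ≤ A ^ s) :
    volume (cube c r) ^ (1 / p - 1 / q) *
      (∫⁻ y in cube c r, (‖f y‖₊ : ℝ≥0∞) ^ q) ^ (1 / q) ≤
    ENNReal.ofReal ((s / (s - q)) ^ (1 / q)) * (volume (cube c r) ^ (1 / p - 1 / s) * A) := by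
  have hs : 0 < s := hq.trans hqs
  have hK : 0 < s / (s - q) := div_pos hs (by linarith)
  have hm0 := cube_vol_ne_zero c hr
  have hmt := cube_vol_ne_top c hr
  have key := aux_key (volume.restrict (cube c r)) (fun y => ‖f y‖) (fun _ => norm_nonneg _)
    hf.norm hq hqs (by simpa using hm0) (by simpa using hmt) A (by
      intro t ht
      rw [Measure.restrict_apply (measurableSet_lt measurable_const hf.norm)]
      convert H t ht using 3
      ext y; simp [and_comm])
  have e : ∀ y, ENNReal.ofReal (‖f y‖ ^ q) = (‖f y‖₊ : ℝ≥0∞) ^ q := fun y => by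
    rw [← ENNReal.ofReal_rpow_of_nonneg (norm_nonneg _) hq.le, ofReal_norm]; rfl
  simp only [e, Measure.restrict_apply_univ] at key
  refine (mul_le_mul_right (ENNReal.rpow_le_rpow key (by positivity : 0 ≤ 1 / q)) _).trans
    (le_of_eq ?_)
  rw [ENNReal.mul_rpow_of_nonneg _ _ (by positivity), ENNReal.mul_rpow_of_nonneg _ _ (by positivity),
    ENNReal.ofReal_rpow_of_pos hK, ← ENNReal.rpow_mul, ← ENNReal.rpow_mul,
    mul_one_div_cancel hq.ne', ENNReal.rpow_one]
  have e2 : volume (cube c r) ^ (1 / p - 1 / s) = volume (cube c r) ^ (1 / p - 1 / q) *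
      volume (cube c r) ^ ((1 - q / s) * (1 / q)) := by
    rw [← ENNReal.rpow_add _ _ hm0 hmt]
    congr 1
    field_simp
    ring
  rw [e2]
  ring

/-- For `1 ≤ q₁ < q₂ < p < ∞` there is a constant `C`, depending only on
`q₁, q₂, p`, such that for every measurable `f` on `ℝⁿ`,
`‖f‖_{M^p_{q₁}} ≤ C ‖f‖_{WM^p_{q₂}} ≤ C ‖f‖_{M^p_{q₂}} ≤ C ‖f‖_{L^{p,∞}}`. -/
theorem morrey_weakMorrey_weakLp_chain {p q₁ q₂ : ℝ}
    (hq₁ : 1 ≤ q₁) (hq₁q₂ : q₁ < q₂) (hq₂p : q₂ < p) :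
    ∃ C : ℝ, 0 < C ∧ ∀ (n : ℕ) (f : En n → ℂ), Measurable f →
      morreyNorm p q₁ f ≤ ENNReal.ofReal C * weakMorreyNorm p q₂ f ∧
      weakMorreyNorm p q₂ f ≤ ENNReal.ofReal C * morreyNorm p q₂ f ∧
      morreyNorm p q₂ f ≤ ENNReal.ofReal C * weakLpNorm p f := by
  have h1 : 0 < q₁ := by linarith
  have h2 : 0 < q₂ := by linarith
  have hp : 0 < p := by linarith
  set C₁ := (q₂ / (q₂ - q₁)) ^ (1 / q₁)
  set C₂ := (p / (p - q₂)) ^ (1 / q₂)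
  refine ⟨max 1 (max C₁ C₂), lt_of_lt_of_le one_pos (le_max_left _ _), fun n f hf => ⟨?_, ?_, ?_⟩⟩
  · refine iSup_le fun c => iSup_le fun r => iSup_le fun hr => ?_
    refine (aux_cube f hf h1 hq₁q₂ c hr (⨆ (t : ℝ) (_ : 0 < t),
        (ENNReal.ofReal t ^ q₂ * volume {y ∈ cube c r | t < ‖f y‖}) ^ (1 / q₂)) ?_).trans ?_
    · intro t ht
      rw [← ENNReal.rpow_inv_le_iff h2, ← one_div]
      exact le_iSup₂ (f := fun (t : ℝ) (_ : 0 < t) =>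
        (ENNReal.ofReal t ^ q₂ * volume {y ∈ cube c r | t < ‖f y‖}) ^ (1 / q₂)) t ht
    · refine mul_le_mul' (ENNReal.ofReal_le_ofReal
        ((le_max_left _ _).trans (le_max_right _ _))) ?_
      exact le_iSup_of_le c (le_iSup₂_of_le r hr le_rfl)
  · have hC : 1 ≤ ENNReal.ofReal (max 1 (max C₁ C₂)) := by
      rw [← ENNReal.ofReal_one]; exact ENNReal.ofReal_le_ofReal (le_max_left _ _)
    refine le_trans ?_ (le_mul_of_one_le_left' hC)
    refine iSup_le fun c => iSup_le fun r => iSup_le fun hr => ?_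
    refine le_iSup_of_le c (le_iSup₂_of_le r hr ?_)
    refine mul_le_mul_right (iSup₂_le fun t ht => ?_) _
    refine ENNReal.rpow_le_rpow ?_ (by positivity)
    refine le_trans ?_ (mul_meas_ge_le_lintegral (μ := volume.restrict (cube c r))
      (f := fun y => (‖f y‖₊ : ℝ≥0∞) ^ q₂) (by fun_prop) (ENNReal.ofReal t ^ q₂))
    refine mul_le_mul_right ?_ _
    rw [Measure.restrict_apply (measurableSet_le measurable_const (by fun_prop))]
    refine measure_mono fun y hy => ⟨?_, hy.1⟩
    refine ENNReal.rpow_le_rpow ?_ h2.le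
    change _ ≤ ‖f y‖ₑ
    rw [← ofReal_norm]
    exact ENNReal.ofReal_le_ofReal hy.2.le
  · refine iSup_le fun c => iSup_le fun r => iSup_le fun hr => ?_
    refine (aux_cube f hf h2 hq₂p c hr (weakLpNorm p f) ?_).trans ?_
    · intro t ht
      have h : ENNReal.ofReal t * volume {x : En n | t < ‖f x‖} ^ (1 / p) ≤ weakLpNorm p f :=
        le_iSup₂ (f := fun (t : ℝ) (_ : 0 < t) =>
          ENNReal.ofReal t * volume {x : En n | t < ‖f x‖} ^ (1 / p)) t ht
      refine le_trans ?_ (ENNReal.rpow_le_rpow h hp.le)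
      rw [ENNReal.mul_rpow_of_nonneg _ _ hp.le, ← ENNReal.rpow_mul, one_div_mul_cancel hp.ne',
        ENNReal.rpow_one]
      exact mul_le_mul_right (measure_mono fun y hy => hy.2) _
    · rw [sub_self, ENNReal.rpow_zero, one_mul]
      exact mul_le_mul_left (ENNReal.ofReal_le_ofReal
        ((le_max_right _ _).trans (le_max_right _ _))) _
end
end
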